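/- Lower bound for quantum state merging: Let ε > 0 and let Ψ_RBC be a pure state on R×B×C. Suppose given finite nonempty index types S_A, S_B, M, T_A, T_B with |C|·|S_A| = |M|·|T_A| and |S_B|·|M| = |C|·|T_B|; a unit vector θ on S_A×S_B; a unitary matrix U : Matrix (M×T_A) (C×S_A) ℂ; and a unitary matrix V : Matrix (B×C×T_B) (B×S_B×M) ℂ. Let Φ be the density matrix obtained from |Ψ⟩⟨Ψ| ⊗ |θ⟩⟨θ| by first applying U on the factors C×S_A (tensored with the identity on the remaining factors), producing factors M×T_A, and then applying V on the factors B×S_B×M (tensored with the identity on the remaining factors), producing factors B×C×T_B, with the resulting factors reordered as R×B×C×T_A×T_B. If the marginal Φ_RBC lies in B^ε(|Ψ⟩⟨Ψ|_RBC), then log|M| ≥ (1/2)·Imax^ε(R : C)_{Ψ_RC}. -/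

import Mathlib

open scoped Kronecker BigOperators
open Matrix
open scoped ComplexOrder Classical

noncomputable section

/-- A density matrix: positive semidefinite with unit trace. -/
def IsDensityMatrix {d : Type*} [Fintype d] (ρ : Matrix d d ℂ) : Prop :=
  ρ.PosSemidef ∧ ρ.trace = 1

/-- Loewner order on Hermitian matrices: `A ≤ B` iff `B - A` is positive semidefinite. -/
def LoewnerLE {d : Type*} [Fintype d] (A B : Matrix d d ℂ) : Prop := (B - A).PosSemidef

/-- Partial trace over the second tensor factor. -/
def ptrace2 {d₁ d₂ : Type*} [Fintype d₂] (M : Matrix (d₁ × d₂) (d₁ × d₂) ℂ) :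
    Matrix d₁ d₁ ℂ :=
  fun i i' => ∑ k, M (i, k) (i', k)

/-- Partial trace over the first tensor factor. -/
def ptrace1 {d₁ d₂ : Type*} [Fintype d₁] (M : Matrix (d₁ × d₂) (d₁ × d₂) ℂ) :
    Matrix d₂ d₂ ℂ :=
  fun j j' => ∑ k, M (k, j) (k, j')

/-- Functional calculus for Hermitian matrices: apply `f` to the eigenvalues. -/
def hermCFC {d : Type*} [Fintype d] [DecidableEq d] (f : ℝ → ℝ) (A : Matrix d d ℂ) :
    Matrix d d ℂ :=
  if hA : A.IsHermitian then
    (hA.eigenvectorUnitary : Matrix d d ℂ) *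
      Matrix.diagonal (fun i => (f (hA.eigenvalues i) : ℂ)) *
      (star (hA.eigenvectorUnitary : Matrix d d ℂ))
  else 0

/-- Matrix logarithm, base 2, applied to nonzero eigenvalues. -/
def matLog2 {d : Type*} [Fintype d] [DecidableEq d] (A : Matrix d d ℂ) : Matrix d d ℂ :=
  hermCFC (Real.logb 2) A

/-- Positive semidefinite square root (via functional calculus). -/
def matSqrt {d : Type*} [Fintype d] [DecidableEq d] (A : Matrix d d ℂ) : Matrix d d ℂ :=
  hermCFC Real.sqrt A

/-- Support containment: the kernel of `σ` is contained in the kernel of `ρ`. -/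
def SupportLE {d : Type*} [Fintype d] (ρ σ : Matrix d d ℂ) : Prop :=
  ∀ v : d → ℂ, σ.mulVec v = 0 → ρ.mulVec v = 0

/-- Relative entropy, base 2, as a real number (meaningful when supports are nested). -/
def relentR {d : Type*} [Fintype d] [DecidableEq d] (ρ σ : Matrix d d ℂ) : ℝ :=
  ((ρ * matLog2 ρ).trace - (ρ * matLog2 σ).trace).re

/-- Relative entropy `D(ρ‖σ)`, base 2, valued in the extended reals: `+∞` unless
the support of `ρ` is contained in the support of `σ`. -/
def relent {d : Type*} [Fintype d] [DecidableEq d] (ρ σ : Matrix d d ℂ) : EReal :=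
  if SupportLE ρ σ then ((relentR ρ σ : ℝ) : EReal) else ⊤

/-- Mutual information `I(A:B)_ρ = D(ρ_AB ‖ ρ_A ⊗ ρ_B)`. -/
def mutInfo {d₁ d₂ : Type*} [Fintype d₁] [Fintype d₂] [DecidableEq d₁] [DecidableEq d₂]
    (ρ : Matrix (d₁ × d₂) (d₁ × d₂) ℂ) : EReal :=
  relent ρ (ptrace2 ρ ⊗ₖ ptrace1 ρ)

/-- Fidelity `F(ρ,σ) = Tr √(√σ ρ √σ)`. -/
def fidelity {d : Type*} [Fintype d] [DecidableEq d] (ρ σ : Matrix d d ℂ) : ℝ :=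
  ((matSqrt (matSqrt σ * ρ * matSqrt σ)).trace).re

/-- Purified distance `P(ρ,σ) = √(1 - F(ρ,σ)²)`. -/
def pdist {d : Type*} [Fintype d] [DecidableEq d] (ρ σ : Matrix d d ℂ) : ℝ :=
  Real.sqrt (1 - (fidelity ρ σ) ^ 2)

/-- Max-relative entropy `Dmax(ρ‖σ) = inf {λ : ρ ≤ 2^λ σ}`, valued in the extended reals. -/
def dmax {d : Type*} [Fintype d] (ρ σ : Matrix d d ℂ) : EReal :=
  sInf {x : EReal | ∃ l : ℝ, x = (l : EReal) ∧ LoewnerLE ρ (((2 : ℝ) ^ l) • σ)}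

/-- Max-information `Imax(A:B)_ρ`. -/
def imax {d₁ d₂ : Type*} [Fintype d₁] [Fintype d₂]
    (ρ : Matrix (d₁ × d₂) (d₁ × d₂) ℂ) : EReal :=
  ⨅ σ : {σ : Matrix d₂ d₂ ℂ // IsDensityMatrix σ}, dmax ρ (ptrace2 ρ ⊗ₖ σ.1)

/-- Smooth max-information `Imax^ε(A:B)_ρ`. -/
def imaxEps {d₁ d₂ : Type*} [Fintype d₁] [Fintype d₂] [DecidableEq d₁] [DecidableEq d₂]
    (ε : ℝ) (ρ : Matrix (d₁ × d₂) (d₁ × d₂) ℂ) : EReal :=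
  ⨅ ρ' : {ρ' : Matrix (d₁ × d₂) (d₁ × d₂) ℂ // IsDensityMatrix ρ' ∧ pdist ρ ρ' ≤ ε},
    imax ρ'.1

/-- The `j`-th term of the convex split: `ρ` on `P` and the `j`-th copy of `Q`, and
`σ` on every other copy of `Q`. -/
def blockState {P Q : Type*} [Fintype Q] [DecidableEq Q]
    (ρ : Matrix (P × Q) (P × Q) ℂ) (σ : Matrix Q Q ℂ) (n : ℕ) (j : Fin n) :
    Matrix (P × (Fin n → Q)) (P × (Fin n → Q)) ℂ :=
  fun x y => ρ (x.1, x.2 j) (y.1, y.2 j) * ∏ i ∈ Finset.univ.erase j, σ (x.2 i) (y.2 i)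

/-- The convex-split state `τ = (1/n) Σ_j ρ_{PQ_j} ⊗ σ_{Q_1} ⊗ ⋯ ⊗ σ_{Q_n}` (omitting `j`). -/
def convexSplit {P Q : Type*} [Fintype Q] [DecidableEq Q]
    (ρ : Matrix (P × Q) (P × Q) ℂ) (σ : Matrix Q Q ℂ) (n : ℕ) :
    Matrix (P × (Fin n → Q)) (P × (Fin n → Q)) ℂ :=
  ((n : ℂ)⁻¹) • ∑ j : Fin n, blockState ρ σ n j

/-- A finite nonempty index type. -/
structure FinIdx where
  carrier : Type
  [fin : Fintype carrier]
  [deq : DecidableEq carrier]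
  [ne : Nonempty carrier]

attribute [instance] FinIdx.fin FinIdx.deq FinIdx.ne


section Protocol

variable {R B C SA SB M TA TB : Type}
  [Fintype R] [Fintype B] [Fintype C] [Fintype SA] [Fintype SB]
  [Fintype M] [Fintype TA] [Fintype TB]

/-- The global pure state after Alice applies the unitary `U` on her registers `C × SA`
(producing `M × TA`), starting from `Ψ_RBC ⊗ θ_{SA,SB}`. -/
def stepU (ψ : (R × C) × B → ℂ) (θ : SA × SB → ℂ)
    (U : Matrix (M × TA) (C × SA) ℂ) :
    (R × B × SB) × (M × TA) → ℂ :=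
  fun x => ∑ cs : C × SA,
    U x.2 cs * ψ ((x.1.1, cs.1), x.1.2.1) * θ (cs.2, x.1.2.2)

/-- The global pure state after Bob additionally applies the unitary `V` on his
registers `B × SB × M` (producing `B × C × TB`). -/
def stepV (ψ : (R × C) × B → ℂ) (θ : SA × SB → ℂ)
    (U : Matrix (M × TA) (C × SA) ℂ) (V : Matrix (B × (C × TB)) (B × (SB × M)) ℂ) :
    (R × TA) × (B × (C × TB)) → ℂ :=
  fun y => ∑ x : B × (SB × M),
    V y.2 x * stepU ψ θ U ((y.1.1, x.1, x.2.1), (x.2.2, y.1.2))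

/-- The final global pure state, with factors reordered as `((R × C) × B) × (TA × TB)`. -/
def finalVec (ψ : (R × C) × B → ℂ) (θ : SA × SB → ℂ)
    (U : Matrix (M × TA) (C × SA) ℂ) (V : Matrix (B × (C × TB)) (B × (SB × M)) ℂ) :
    ((R × C) × B) × (TA × TB) → ℂ :=
  fun z => stepV ψ θ U V ((z.1.1.1, z.2.1), (z.1.2, (z.1.1.2, z.2.2)))

end Protocol

section FunctionalCalculus

variable {d n : Type*} [Fintype d] [DecidableEq d] [Fintype n]

theorem hermCFC_mul (f g : ℝ → ℝ) (A : Matrix d d ℂ) :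
    hermCFC f A * hermCFC g A = hermCFC (fun x => f x * g x) A := by
  unfold hermCFC
  split_ifs with hA
  · have h : star (hA.eigenvectorUnitary : Matrix d d ℂ) * hA.eigenvectorUnitary = 1 :=
      Unitary.coe_star_mul_self _
    calc _ = (hA.eigenvectorUnitary : Matrix d d ℂ) *
            Matrix.diagonal (fun i => (f (hA.eigenvalues i) : ℂ)) *
            (star (hA.eigenvectorUnitary : Matrix d d ℂ) * hA.eigenvectorUnitary) *
            Matrix.diagonal (fun i => (g (hA.eigenvalues i) : ℂ)) *
            star (hA.eigenvectorUnitary : Matrix d d ℂ) := by simp only [Matrix.mul_assoc]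
      _ = _ := by
        rw [h, Matrix.mul_one, Matrix.mul_assoc (hA.eigenvectorUnitary : Matrix d d ℂ),
          Matrix.diagonal_mul_diagonal]
        simp only [Complex.ofReal_mul]
  · simp

theorem hermCFC_sub (f g : ℝ → ℝ) (A : Matrix d d ℂ) :
    hermCFC f A - hermCFC g A = hermCFC (fun x => f x - g x) A := by
  unfold hermCFC
  split_ifs with hA
  · rw [← Matrix.sub_mul, ← Matrix.mul_sub, Matrix.diagonal_sub]
    simp only [Complex.ofReal_sub]
  · simp

theorem hermCFC_one {A : Matrix d d ℂ} (hA : A.IsHermitian) :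
    hermCFC (fun _ => 1) A = 1 := by
  have h : (hA.eigenvectorUnitary : Matrix d d ℂ) * star (hA.eigenvectorUnitary : Matrix d d ℂ)
      = 1 := Unitary.coe_mul_star_self _
  simp [hermCFC, hA, h]

theorem hermCFC_id {A : Matrix d d ℂ} (hA : A.IsHermitian) : hermCFC (fun x => x) A = A := by
  conv_rhs => rw [hA.spectral_theorem, Unitary.conjStarAlgAut_apply]
  simp only [hermCFC, dif_pos hA]
  rfl

theorem hermCFC_congr {f g : ℝ → ℝ} {A : Matrix d d ℂ} (hA : A.PosSemidef)
    (h : ∀ x, 0 ≤ x → f x = g x) : hermCFC f A = hermCFC g A := by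
  simp only [hermCFC, dif_pos hA.isHermitian]
  congr 3
  funext i
  rw [h _ (hA.eigenvalues_nonneg i)]

theorem posSemidef_hermCFC {f : ℝ → ℝ} (hf : ∀ x, 0 ≤ f x) (A : Matrix d d ℂ) :
    (hermCFC f A).PosSemidef := by
  unfold hermCFC
  split_ifs with hA
  · refine Matrix.PosSemidef.mul_mul_conjTranspose_same
      (Matrix.PosSemidef.diagonal fun i => ?_) _
    have := hf (hA.eigenvalues i)
    simpa using this
  · exact Matrix.PosSemidef.zero

theorem posSemidef_matSqrt (A : Matrix d d ℂ) : (matSqrt A).PosSemidef :=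
  posSemidef_hermCFC Real.sqrt_nonneg A

theorem matSqrt_conjTranspose (A : Matrix d d ℂ) : (matSqrt A)ᴴ = matSqrt A :=
  (posSemidef_matSqrt A).isHermitian

theorem matSqrt_mul_self {A : Matrix d d ℂ} (hA : A.PosSemidef) : matSqrt A * matSqrt A = A := by
  rw [matSqrt, hermCFC_mul, hermCFC_congr hA fun x hx => Real.mul_self_sqrt hx,
    hermCFC_id hA.isHermitian]

/-- A polar decomposition: `B = √(BBᴴ) W` with `W` a contraction. -/
theorem exists_polar (B : Matrix d n ℂ) :
    ∃ W : Matrix d n ℂ, B = matSqrt (B * Bᴴ) * W ∧ matSqrt (B * Bᴴ) = W * Bᴴ ∧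
      (1 - W * Wᴴ).PosSemidef := by
  have hA : (B * Bᴴ).PosSemidef := Matrix.posSemidef_self_mul_conjTranspose B
  set A := B * Bᴴ with hAdef
  set J := hermCFC (fun x => (Real.sqrt x)⁻¹) A with hJ
  have hJH : Jᴴ = J :=
    (posSemidef_hermCFC (fun x => inv_nonneg.2 (Real.sqrt_nonneg x)) A).isHermitian
  set E := hermCFC (fun x => Real.sqrt x * (Real.sqrt x)⁻¹) A with hE
  have hSJ : matSqrt A * J = E := hermCFC_mul _ _ _
  have hJS : J * matSqrt A = E := by
    rw [hE, hJ, matSqrt, hermCFC_mul]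
    simp only [mul_comm]
  have hSE : matSqrt A * E = matSqrt A := by
    rw [matSqrt, hE, hermCFC_mul]
    exact hermCFC_congr hA fun x _ => by
      by_cases h : Real.sqrt x = 0
      · simp [h]
      · field_simp
  have hF : (1 - E).PosSemidef := by
    rw [← hermCFC_one hA.isHermitian, hE, hermCFC_sub]
    refine posSemidef_hermCFC (fun x => ?_) A
    by_cases h : Real.sqrt x = 0 <;> simp [h]
  have hEH : Eᴴ = E := by
    have := hF.isHermitian
    rw [Matrix.IsHermitian, Matrix.conjTranspose_sub, Matrix.conjTranspose_one] at this
    exact sub_right_injective this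
  have hSS := matSqrt_mul_self hA
  have hES : E * matSqrt A = matSqrt A := by
    have h := congrArg Matrix.conjTranspose hSE
    rwa [Matrix.conjTranspose_mul, matSqrt_conjTranspose, hEH] at h
  have hEA : E * A = A := by
    conv_lhs => rw [← hSS, ← Matrix.mul_assoc, hES, hSS]
  have hEB : E * B = B := by
    have h : (1 - E) * B * ((1 - E) * B)ᴴ = 0 := by
      rw [Matrix.conjTranspose_mul, ← Matrix.mul_assoc, Matrix.mul_assoc (1 - E) B, ← hAdef,
        Matrix.sub_mul, hEA, Matrix.one_mul, sub_self, Matrix.zero_mul]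
    rw [Matrix.self_mul_conjTranspose_eq_zero, Matrix.sub_mul, Matrix.one_mul, sub_eq_zero] at h
    exact h.symm
  refine ⟨J * B, ?_, ?_, ?_⟩
  · rw [← Matrix.mul_assoc, hSJ, hEB]
  · rw [Matrix.mul_assoc, ← hAdef, ← hSS, ← Matrix.mul_assoc, hJS, hSS, hES]
  · have : J * B * (J * B)ᴴ = E * E := by
      rw [Matrix.conjTranspose_mul, hJH, ← Matrix.mul_assoc, Matrix.mul_assoc J B, ← hAdef, ← hSS,
        ← Matrix.mul_assoc, hJS, Matrix.mul_assoc, hSJ]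
    have hEE : E * E = E := by
      conv_lhs => rw [← hJS, Matrix.mul_assoc, hJS, hSE]
      exact hJS
    rwa [this, hEE]

end FunctionalCalculus

section Fidelity

variable {d n : Type*} [Fintype d] [Fintype n]

theorem trace_conjTranspose_mul (P Q : Matrix d n ℂ) :
    (Pᴴ * Q).trace = ∑ i, ∑ j, star (P i j) * Q i j := by
  simp only [Matrix.trace, Matrix.diag, Matrix.mul_apply, Matrix.conjTranspose_apply]
  exact Finset.sum_comm

theorem trace_conjTranspose_mul_self_re (P : Matrix d n ℂ) :
    (Pᴴ * P).trace.re = ∑ i, ∑ j, ‖P i j‖ ^ 2 := by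
  simp only [trace_conjTranspose_mul, Complex.re_sum]
  refine Finset.sum_congr rfl fun i _ => Finset.sum_congr rfl fun j _ => ?_
  rw [Complex.star_def, Complex.conj_mul']
  norm_cast

/-- The Cauchy-Schwarz inequality for the Hilbert-Schmidt inner product. -/
theorem norm_trace_conjTranspose_mul_sq_le (P Q : Matrix d n ℂ) :
    ‖(Pᴴ * Q).trace‖ ^ 2 ≤ (Pᴴ * P).trace.re * (Qᴴ * Q).trace.re := by
  rw [trace_conjTranspose_mul_self_re, trace_conjTranspose_mul_self_re, trace_conjTranspose_mul]
  simp only [← Fintype.sum_prod_type' (f := fun i j => star (P i j) * Q i j),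
    ← Fintype.sum_prod_type' (f := fun i j => ‖P i j‖ ^ 2),
    ← Fintype.sum_prod_type' (f := fun i j => ‖Q i j‖ ^ 2)]
  refine le_trans ?_ (Finset.sum_mul_sq_le_sq_mul_sq _ _ _)
  gcongr
  refine (norm_sum_le _ _).trans_eq (Finset.sum_congr rfl fun x _ => ?_)
  rw [norm_mul, norm_star]

variable [DecidableEq d]

theorem trace_mul_contraction_le {S T : Matrix d d ℂ} (hTH : Tᴴ = T) (hT : T * T = S)
    {W : Matrix d n ℂ} (hW : (1 - W * Wᴴ).PosSemidef) :
    ((T * W)ᴴ * (T * W)).trace.re ≤ S.trace.re := by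
  have h := (hW.mul_mul_conjTranspose_same T).trace_nonneg
  rw [hTH, Matrix.mul_sub, Matrix.sub_mul, Matrix.mul_one, hT, Matrix.trace_sub] at h
  have h' : ((T * W)ᴴ * (T * W)).trace = (T * (W * Wᴴ) * T).trace := by
    rw [Matrix.trace_mul_comm, Matrix.conjTranspose_mul, hTH]
    simp only [Matrix.mul_assoc]
  rw [h']
  have := (Complex.le_def.1 h).1
  simp only [Complex.zero_re, Complex.sub_re] at this
  linarith

/-- One direction of Uhlmann's theorem: overlaps of purifications are bounded by the fidelity. -/
theorem norm_trace_le_fidelity (A B : Matrix d n ℂ) :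
    ‖(Aᴴ * B).trace‖ ≤ fidelity (A * Aᴴ) (B * Bᴴ) := by
  obtain ⟨W, hW, -, hW1⟩ := exists_polar B
  set σ := B * Bᴴ
  obtain ⟨Y, hY, -, hY1⟩ := exists_polar (matSqrt σ * A)
  have hX : matSqrt σ * A * (matSqrt σ * A)ᴴ = matSqrt σ * (A * Aᴴ) * matSqrt σ := by
    rw [Matrix.conjTranspose_mul, matSqrt_conjTranspose]
    simp only [Matrix.mul_assoc]
  rw [hX] at hY
  unfold fidelity
  set S := matSqrt (matSqrt σ * (A * Aᴴ) * matSqrt σ)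
  have hS : S.PosSemidef := posSemidef_matSqrt _
  have hTT := matSqrt_mul_self hS
  have hTH := matSqrt_conjTranspose S
  set T := matSqrt S
  have hAB : Aᴴ * B = (T * Y)ᴴ * (T * W) := by
    have h1 : Aᴴ * B = (matSqrt σ * A)ᴴ * W := by
      conv_lhs => rw [hW]
      rw [Matrix.conjTranspose_mul, matSqrt_conjTranspose, Matrix.mul_assoc]
    rw [h1, hY, Matrix.conjTranspose_mul, Matrix.conjTranspose_mul, hTH, hS.isHermitian.eq, ← hTT]
    simp only [Matrix.mul_assoc]
  rw [hAB]
  have h := norm_trace_conjTranspose_mul_sq_le (T * Y) (T * W)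
  have h1 := trace_mul_contraction_le hTH hTT hY1
  have h2 := trace_mul_contraction_le hTH hTT hW1
  have h0 : 0 ≤ S.trace.re := (Complex.le_def.1 hS.trace_nonneg).1
  have h3 : 0 ≤ ((T * W)ᴴ * (T * W)).trace.re :=
    (Complex.le_def.1 (Matrix.posSemidef_conjTranspose_mul_self _).trace_nonneg).1
  refine (sq_le_sq₀ (norm_nonneg _) h0).1 ?_
  rw [sq S.trace.re]
  exact h.trans (mul_le_mul h1 h2 h3 h0)

theorem fidelity_nonneg (ρ σ : Matrix d d ℂ) : 0 ≤ fidelity ρ σ :=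
  (Complex.le_def.1 (posSemidef_matSqrt _).trace_nonneg).1

theorem fidelity_pure_sq_le (v : d → ℂ) {σ : Matrix d d ℂ} (hσ : σ.PosSemidef) :
    fidelity (Matrix.vecMulVec v (star v)) σ ^ 2 ≤ (star v ⬝ᵥ σ *ᵥ v).re := by
  set X : Matrix d Unit ℂ := Matrix.replicateCol Unit (matSqrt σ *ᵥ v)
  have hX : matSqrt σ * Matrix.vecMulVec v (star v) * matSqrt σ = X * Xᴴ := by
    rw [Matrix.mul_vecMulVec, Matrix.vecMulVec_mul]
    have : star v ᵥ* matSqrt σ = star (matSqrt σ *ᵥ v) := by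
      rw [Matrix.star_mulVec, matSqrt_conjTranspose]
    rw [this]
    ext i j
    simp [X, Matrix.mul_apply, Matrix.vecMulVec_apply]
  obtain ⟨W, -, hW, hW1⟩ := exists_polar X
  have hXX : (Xᴴ * X).trace = star v ⬝ᵥ σ *ᵥ v := by
    have : (Xᴴ * X).trace = star (matSqrt σ *ᵥ v) ⬝ᵥ (matSqrt σ *ᵥ v) := by
      simp [X, Matrix.trace, Matrix.mul_apply, dotProduct]
    rw [this, Matrix.star_mulVec, matSqrt_conjTranspose, ← Matrix.dotProduct_mulVec,
      Matrix.mulVec_mulVec, matSqrt_mul_self hσ]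
  have hWW : (Wᴴ * W).trace.re ≤ 1 := by
    have h := (Complex.le_def.1 (hW1.conjTranspose_mul_mul_same W).trace_nonneg).1
    have him := (Complex.le_def.1 (Matrix.posSemidef_conjTranspose_mul_self W).trace_nonneg).2
    have hre := (Complex.le_def.1 (Matrix.posSemidef_conjTranspose_mul_self W).trace_nonneg).1
    have e : Wᴴ * (1 - W * Wᴴ) * W = Wᴴ * W - (Wᴴ * W) * (Wᴴ * W) := by
      simp only [Matrix.mul_sub, Matrix.sub_mul, Matrix.mul_one, Matrix.mul_assoc]
    have e' : ((Wᴴ * W) * (Wᴴ * W)).trace = (Wᴴ * W).trace * (Wᴴ * W).trace := by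
      generalize Wᴴ * W = G
      simp [Matrix.trace, Matrix.mul_apply]
    rw [e, Matrix.trace_sub, e', Complex.sub_re, Complex.mul_re, ← him] at h
    simp only [Complex.zero_re, Complex.zero_im] at h hre
    nlinarith
  have hF : fidelity (Matrix.vecMulVec v (star v)) σ = (Xᴴ * W).trace.re := by
    rw [fidelity, hX, hW, Matrix.trace_mul_comm]
  have h0 : 0 ≤ (Xᴴ * X).trace.re :=
    (Complex.le_def.1 (Matrix.posSemidef_conjTranspose_mul_self _).trace_nonneg).1
  calc fidelity (Matrix.vecMulVec v (star v)) σ ^ 2 ≤ ‖(Xᴴ * W).trace‖ ^ 2 := by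
        rw [hF, ← sq_abs]
        gcongr
        exact Complex.abs_re_le_norm _
    _ ≤ (Xᴴ * X).trace.re * (Wᴴ * W).trace.re := norm_trace_conjTranspose_mul_sq_le _ _
    _ ≤ (Xᴴ * X).trace.re := mul_le_of_le_one_right h0 hWW
    _ = _ := by rw [hXX]

end Fidelity

section MaxInformation

theorem posSemidef_card_smul_sum_sub {ι d n : Type*} [Fintype ι] [Fintype d] [Fintype n]
    (F : ι → Matrix d n ℂ) :
    ((Fintype.card ι : ℂ) • ∑ i, F i * (F i)ᴴ - (∑ i, F i) * (∑ i, F i)ᴴ).PosSemidef := by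
  have h : (Fintype.card ι : ℂ) • ∑ i, F i * (F i)ᴴ - (∑ i, F i) * (∑ i, F i)ᴴ =
      (2⁻¹ : ℂ) • ∑ i, ∑ j, (F i - F j) * (F i - F j)ᴴ := by
    rw [eq_inv_smul_iff₀ two_ne_zero]
    simp only [Matrix.conjTranspose_sub, Matrix.sub_mul, Matrix.mul_sub, Finset.sum_sub_distrib,
      Finset.sum_const, Finset.card_univ, ← Finset.smul_sum, Matrix.conjTranspose_sum,
      Matrix.sum_mul, Matrix.mul_sum, Nat.cast_smul_eq_nsmul]
    rw [Finset.sum_comm (f := fun i j => F j * (F i)ᴴ), two_smul]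
    abel
  rw [h]
  refine Matrix.PosSemidef.smul (Matrix.posSemidef_sum _ fun i _ =>
    Matrix.posSemidef_sum _ fun j _ => Matrix.posSemidef_self_mul_conjTranspose _) ?_
  norm_num [Complex.le_def]

/-- `G_{XM} ≤ |M| · G_X ⊗ 1_M`, with `G = N Nᴴ` and the tensor factors of `X` separated. -/
theorem posSemidef_card_smul_kronecker_sub {R T M K : Type*} [Fintype R] [Fintype T] [Fintype M]
    [Fintype K] [DecidableEq M] (N : Matrix (R × (T × M)) K ℂ) (ρ : Matrix R R ℂ)
    (ω : Matrix T T ℂ)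
    (hN : ∀ r t r' t', ∑ m, ∑ k, N (r, (t, m)) k * star (N (r', (t', m)) k) = ρ r r' * ω t t') :
    ((Fintype.card M : ℂ) • (ρ ⊗ₖ (ω ⊗ₖ (1 : Matrix M M ℂ))) - N * Nᴴ).PosSemidef := by
  set F : M → M → Matrix (R × (T × M)) K ℂ :=
    fun m a => Matrix.of fun x k => if x.2.2 = a then N (x.1, (x.2.1, m)) k else 0 with hF
  have hdiag : ∑ m, F m m = N := by
    ext ⟨r, t, m⟩ k
    simp [hF, Matrix.sum_apply]
  have hsum : ∑ m, ∑ a, F m a * (F m a)ᴴ = ρ ⊗ₖ (ω ⊗ₖ (1 : Matrix M M ℂ)) := by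
    ext ⟨r, t, a⟩ ⟨r', t', a'⟩
    simp only [hF, Matrix.sum_apply, Matrix.mul_apply, Matrix.conjTranspose_apply, Matrix.of_apply,
      Matrix.kroneckerMap_apply, ← mul_assoc, ← hN]
    rw [Finset.sum_mul]
    refine Finset.sum_congr rfl fun m _ => ?_
    by_cases h : a = a'
    · subst h
      rw [Finset.sum_eq_single a (fun b _ hb => by simp [hb.symm]) (by simp)]
      simp
    · rw [Matrix.one_apply_ne h, mul_zero]
      refine Finset.sum_eq_zero fun b _ => Finset.sum_eq_zero fun k _ => ?_
      by_cases hb : a = b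
      · have : a' ≠ b := fun h' => h (hb.trans h'.symm)
        simp [this]
      · simp [hb]
  have hsplit : (Fintype.card M : ℂ) • (ρ ⊗ₖ (ω ⊗ₖ (1 : Matrix M M ℂ))) - N * Nᴴ =
      ((Fintype.card M : ℂ) • ∑ m, F m m * (F m m)ᴴ - (∑ m, F m m) * (∑ m, F m m)ᴴ) +
        (Fintype.card M : ℂ) • ∑ m, ∑ a ∈ Finset.univ.erase m, F m a * (F m a)ᴴ := by
    rw [hdiag, sub_add_eq_add_sub, ← smul_add, ← Finset.sum_add_distrib, ← hsum]
    congr 3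
    funext m
    exact (Finset.add_sum_erase _ (fun a => F m a * (F m a)ᴴ) (Finset.mem_univ m)).symm
  rw [hsplit]
  refine (posSemidef_card_smul_sum_sub fun m => F m m).add (Matrix.PosSemidef.smul
    (Matrix.posSemidef_sum _ fun i _ => Matrix.posSemidef_sum _ fun j _ =>
      Matrix.posSemidef_self_mul_conjTranspose _) (Nat.cast_nonneg _))

theorem ptrace2_mul_conjTranspose_of_marginal {R T M K : Type*} [Fintype T] [Fintype M]
    [Fintype K] (N : Matrix (R × (T × M)) K ℂ) (ρ : Matrix R R ℂ) {ω : Matrix T T ℂ} (hω : IsDensityMatrix ω)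
    (hN : ∀ r t r' t', ∑ m, ∑ k, N (r, (t, m)) k * star (N (r', (t', m)) k) = ρ r r' * ω t t') :
    ptrace2 (N * Nᴴ) = ρ := by
  ext r r'
  have h : ∀ t, ∑ m, ∑ k, N (r, (t, m)) k * star (N (r', (t, m)) k) = ρ r r' * ω t t :=
    fun t => hN r t r' t
  simp only [ptrace2, Matrix.mul_apply, Matrix.conjTranspose_apply, Fintype.sum_prod_type, h]
  have hω' := hω.2
  simp only [Matrix.trace, Matrix.diag] at hω'
  rw [← Finset.mul_sum, hω', mul_one]

variable {R C T M S K : Type*} [Fintype R] [Fintype C] [Fintype T] [Fintype M] [Fintype S]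
  [Fintype K] [DecidableEq R] [DecidableEq T] [DecidableEq M]

theorem ptrace2_one_kronecker_conj (L : Matrix C S ℂ) (G : Matrix (R × S) (R × S) ℂ) (r r' : R) :
    ptrace2 (((1 : Matrix R R ℂ) ⊗ₖ L) * G * ((1 : Matrix R R ℂ) ⊗ₖ L)ᴴ) r r' =
      (Lᴴ * L * G.submatrix (Prod.mk r) (Prod.mk r')).trace := by
  have h : (Lᴴ * L * G.submatrix (Prod.mk r) (Prod.mk r')).trace =
      (L * G.submatrix (Prod.mk r) (Prod.mk r') * Lᴴ).trace := by
    rw [Matrix.mul_assoc, Matrix.trace_mul_comm]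
  rw [h]
  simp only [ptrace2, Matrix.trace, Matrix.diag]
  refine Finset.sum_congr rfl fun c _ => ?_
  simp only [Matrix.mul_apply, Fintype.sum_prod_type, Matrix.kroneckerMap_apply,
    Matrix.conjTranspose_apply, Matrix.submatrix_apply, Matrix.one_apply, ite_mul, one_mul,
    zero_mul, Finset.sum_ite_irrel, Finset.sum_const_zero, Finset.sum_ite_eq, Finset.mem_univ,
    if_true, apply_ite star, star_zero, mul_ite, mul_zero]

theorem ptrace2_sum_one_kronecker_conj [DecidableEq S] {I : Type*} [Fintype I]
    (L : I → Matrix C S ℂ)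
    (hL : ∑ s, (L s)ᴴ * L s = 1) (G : Matrix (R × S) (R × S) ℂ) :
    ptrace2 (∑ s, ((1 : Matrix R R ℂ) ⊗ₖ L s) * G * ((1 : Matrix R R ℂ) ⊗ₖ L s)ᴴ) =
      ptrace2 G := by
  ext r r'
  have h : ptrace2 (∑ s, ((1 : Matrix R R ℂ) ⊗ₖ L s) * G * ((1 : Matrix R R ℂ) ⊗ₖ L s)ᴴ) r r' =
      ∑ s, ptrace2 (((1 : Matrix R R ℂ) ⊗ₖ L s) * G * ((1 : Matrix R R ℂ) ⊗ₖ L s)ᴴ) r r' := by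
    simp only [ptrace2, Matrix.sum_apply]
    exact Finset.sum_comm
  simp only [h, ptrace2_one_kronecker_conj]
  rw [← Matrix.trace_sum, ← Matrix.sum_mul, hL, Matrix.one_mul]
  rfl

/-- A state which arises by applying a local isometry followed by a partial trace on `T × M`
to a state with marginal `ρ_R ⊗ ω_T` has max-information at most `2 log |M|`. -/
theorem imax_sum_one_kronecker_conj_le [Nonempty M] {I : Type*} [Fintype I]
    (N : Matrix (R × (T × M)) K ℂ) (ρ : Matrix R R ℂ) {ω : Matrix T T ℂ} (hω : IsDensityMatrix ω)
    (hN : ∀ r t r' t', ∑ m, ∑ k, N (r, (t, m)) k * star (N (r', (t', m)) k) = ρ r r' * ω t t')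
    (L : I → Matrix C (T × M) ℂ) (hL : ∑ s, (L s)ᴴ * L s = 1) :
    imax (∑ s, ((1 : Matrix R R ℂ) ⊗ₖ L s) * (N * Nᴴ) * ((1 : Matrix R R ℂ) ⊗ₖ L s)ᴴ) ≤
      ((2 * Real.logb 2 (Fintype.card M) : ℝ) : EReal) := by
  have hM : (0 : ℝ) < Fintype.card M := by exact_mod_cast Fintype.card_pos
  have hM' : (Fintype.card M : ℂ) ≠ 0 := by exact_mod_cast hM.ne'
  have hω1 : (ω ⊗ₖ (1 : Matrix M M ℂ)).PosSemidef := hω.1.kronecker Matrix.PosSemidef.one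
  set σ : Matrix C C ℂ :=
    (Fintype.card M : ℂ)⁻¹ • ∑ s, L s * (ω ⊗ₖ (1 : Matrix M M ℂ)) * (L s)ᴴ with hσdef
  have hσ : IsDensityMatrix σ := by
    refine ⟨(Matrix.posSemidef_sum _ fun s _ => hω1.mul_mul_conjTranspose_same (L s)).smul ?_, ?_⟩
    · rw [← Complex.ofReal_natCast, ← Complex.ofReal_inv]
      exact Complex.zero_le_real.2 (inv_nonneg.2 hM.le)
    · have : ∀ s, (L s * (ω ⊗ₖ (1 : Matrix M M ℂ)) * (L s)ᴴ).trace =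
          ((L s)ᴴ * L s * (ω ⊗ₖ (1 : Matrix M M ℂ))).trace := fun s => by
        rw [Matrix.trace_mul_comm, Matrix.mul_assoc]
      rw [hσdef, Matrix.trace_smul, Matrix.trace_sum]
      simp only [this]
      rw [← Matrix.trace_sum, ← Matrix.sum_mul, hL, Matrix.one_mul, Matrix.trace_kronecker, hω.2,
        Matrix.trace_one]
      simp [hM']
  refine (iInf_le _ ⟨σ, hσ⟩).trans (sInf_le ⟨_, rfl, ?_⟩)
  rw [ptrace2_sum_one_kronecker_conj L hL, ptrace2_mul_conjTranspose_of_marginal N ρ hω hN,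
    LoewnerLE]
  have hpow : (2 : ℝ) ^ (2 * Real.logb 2 (Fintype.card M)) = (Fintype.card M : ℝ) ^ 2 := by
    rw [mul_comm, Real.rpow_mul zero_le_two, Real.rpow_logb two_pos (by norm_num) hM,
      Real.rpow_two]
  have hrhs : ((Fintype.card M : ℝ) ^ 2) • (ρ ⊗ₖ σ) =
      ∑ s, ((1 : Matrix R R ℂ) ⊗ₖ L s) *
        ((Fintype.card M : ℂ) • (ρ ⊗ₖ (ω ⊗ₖ (1 : Matrix M M ℂ)))) *
          ((1 : Matrix R R ℂ) ⊗ₖ L s)ᴴ := by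
    have hs : ∀ s, ((1 : Matrix R R ℂ) ⊗ₖ L s) *
        ((Fintype.card M : ℂ) • (ρ ⊗ₖ (ω ⊗ₖ (1 : Matrix M M ℂ)))) *
          ((1 : Matrix R R ℂ) ⊗ₖ L s)ᴴ = (Fintype.card M : ℂ) •
          (ρ ⊗ₖ (L s * (ω ⊗ₖ (1 : Matrix M M ℂ)) * (L s)ᴴ)) := fun s => by
      rw [Matrix.conjTranspose_kronecker, Matrix.mul_smul, Matrix.smul_mul,
        ← Matrix.mul_kronecker_mul, ← Matrix.mul_kronecker_mul, Matrix.conjTranspose_one,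
        Matrix.one_mul, Matrix.mul_one]
    simp only [hs]
    ext ⟨r, c⟩ ⟨r', c'⟩
    simp only [hσdef, Matrix.smul_apply, Matrix.sum_apply, Matrix.kroneckerMap_apply, smul_eq_mul,
      Complex.real_smul, ← Finset.mul_sum]
    push_cast
    field_simp
  rw [hpow, hrhs, ← Finset.sum_sub_distrib]
  refine Matrix.posSemidef_sum _ fun s _ => ?_
  rw [← Matrix.sub_mul, ← Matrix.mul_sub]
  exact (posSemidef_card_smul_kronecker_sub N ρ ω hN).mul_mul_conjTranspose_same _

end MaxInformation

section StateMerging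

theorem exists_unit_vector_sum_eq {ι : Type*} [Fintype ι] [Nonempty ι] (w : ι → ℂ) :
    ∃ u : ι → ℂ, ∑ i, ‖u i‖ ^ 2 = 1 ∧
      ∑ i, star (u i) * w i = (Real.sqrt (∑ i, ‖w i‖ ^ 2) : ℂ) := by
  classical
  set s := ∑ i, ‖w i‖ ^ 2 with hs
  have hs0 : 0 ≤ s := Finset.sum_nonneg fun i _ => sq_nonneg _
  rcases hs0.eq_or_lt with h | h
  · have hw : ∀ i, w i = 0 := fun i => by
      have := (Finset.sum_eq_zero_iff_of_nonneg fun i _ => sq_nonneg ‖w i‖).1 (hs ▸ h.symm) i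
        (Finset.mem_univ i)
      simpa using this
    refine ⟨Pi.single (Classical.arbitrary ι) 1, ?_, ?_⟩
    · rw [Finset.sum_eq_single (Classical.arbitrary ι) (fun b _ hb => by simp [hb]) (by simp)]
      simp
    · simp [hw, ← h]
  · have hr : 0 < Real.sqrt s := Real.sqrt_pos.2 h
    refine ⟨fun i => (Real.sqrt s : ℂ)⁻¹ * w i, ?_, ?_⟩
    · have : ∀ i, ‖(Real.sqrt s : ℂ)⁻¹ * w i‖ ^ 2 = s⁻¹ * ‖w i‖ ^ 2 := fun i => by
        rw [norm_mul, norm_inv, Complex.norm_real, Real.norm_of_nonneg hr.le, mul_pow, inv_pow,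
          Real.sq_sqrt hs0]
      simp only [this]
      rw [← Finset.mul_sum, ← hs, inv_mul_cancel₀ h.ne']
    · have : ∀ i, star ((Real.sqrt s : ℂ)⁻¹ * w i) * w i =
          (((Real.sqrt s)⁻¹ * ‖w i‖ ^ 2 : ℝ) : ℂ) := fun i => by
        rw [star_mul', mul_assoc, Complex.star_def, Complex.conj_mul', map_inv₀,
          Complex.conj_ofReal]
        push_cast
        rfl
      simp only [this]
      rw [← Complex.ofReal_sum, ← Finset.mul_sum, ← hs]
      congr 1
      rw [inv_mul_eq_div, Real.div_sqrt]

theorem sum_mul_star_eq_one {ι : Type*} [Fintype ι] {v : ι → ℂ} (hv : ∑ i, ‖v i‖ ^ 2 = 1) :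
    ∑ i, v i * star (v i) = 1 := by
  simp only [Complex.star_def, Complex.mul_conj']
  exact_mod_cast hv

theorem ptrace2_vecMulVec {d₁ d₂ : Type*} [Fintype d₂] (v : d₁ × d₂ → ℂ) :
    ptrace2 (Matrix.vecMulVec v (star v)) =
      (Matrix.of fun i k => v (i, k)) * (Matrix.of fun i k => v (i, k))ᴴ := by
  ext i i'
  simp [ptrace2, Matrix.vecMulVec_apply, Matrix.mul_apply]

theorem isDensityMatrix_ptrace2_vecMulVec {d₁ d₂ : Type*} [Fintype d₁] [Fintype d₂]
    {v : d₁ × d₂ → ℂ} (hv : ∑ i, ‖v i‖ ^ 2 = 1) :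
    IsDensityMatrix (ptrace2 (Matrix.vecMulVec v (star v))) := by
  refine ⟨?_, ?_⟩
  · rw [ptrace2_vecMulVec]
    exact Matrix.posSemidef_self_mul_conjTranspose _
  · rw [← sum_mul_star_eq_one hv, Fintype.sum_prod_type]
    rfl

theorem dotProduct_ptrace2_vecMulVec {d₁ d₂ : Type*} [Fintype d₁] [Fintype d₂]
    (u : d₁ → ℂ) (v : d₁ × d₂ → ℂ) :
    (star u ⬝ᵥ ptrace2 (Matrix.vecMulVec v (star v)) *ᵥ u).re =
      ∑ k, ‖∑ i, star (u i) * v (i, k)‖ ^ 2 := by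
  rw [ptrace2_vecMulVec]
  set N : Matrix d₁ d₂ ℂ := Matrix.of fun i k => v (i, k)
  have h : star u ⬝ᵥ (N * Nᴴ) *ᵥ u = ∑ k, ((‖(star u ᵥ* N) k‖ ^ 2 : ℝ) : ℂ) := by
    rw [← Matrix.mulVec_mulVec, Matrix.dotProduct_mulVec, show Nᴴ *ᵥ u = star (star u ᵥ* N) by
      rw [Matrix.star_vecMul, star_star]]
    refine Finset.sum_congr rfl fun k _ => ?_
    rw [Pi.star_apply, Complex.star_def, Complex.mul_conj']
    push_cast
    rfl
  rw [h, ← Complex.ofReal_sum, Complex.ofReal_re]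
  rfl

theorem trace_eq_trace_ptrace2 {d₁ d₂ : Type*} [Fintype d₁] [Fintype d₂]
    (A : Matrix (d₁ × d₂) (d₁ × d₂) ℂ) : A.trace = (ptrace2 A).trace :=
  Fintype.sum_prod_type _

variable {R B C SA SB M TA TB : Type} [Fintype B] [Fintype SA] [Fintype SB]

/-- The initial state `ψ ⊗ θ`, with rows `R × C`. -/
def initialMatrix (ψ : (R × C) × B → ℂ) (θ : SA × SB → ℂ) : Matrix (R × C) (SA × (B × SB)) ℂ :=
  Matrix.of fun x y => ψ (x, y.2.1) * θ (y.1, y.2.2)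

theorem initialMatrix_mul_conjTranspose (ψ : (R × C) × B → ℂ) {θ : SA × SB → ℂ}
    (hθ : ∑ i, ‖θ i‖ ^ 2 = 1) :
    initialMatrix ψ θ * (initialMatrix ψ θ)ᴴ = ptrace2 (Matrix.vecMulVec ψ (star ψ)) := by
  ext x x'
  simp only [initialMatrix, Matrix.mul_apply, Matrix.conjTranspose_apply, Matrix.of_apply, ptrace2,
    Matrix.vecMulVec_apply, Pi.star_apply, star_mul', Fintype.sum_prod_type]
  rw [Finset.sum_comm]
  refine Finset.sum_congr rfl fun b _ => ?_
  have h := sum_mul_star_eq_one hθ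
  rw [Fintype.sum_prod_type] at h
  rw [← mul_one (ψ (x, b) * _), ← h, Finset.mul_sum]
  refine Finset.sum_congr rfl fun s _ => ?_
  rw [Finset.mul_sum]
  refine Finset.sum_congr rfl fun s' _ => ?_
  ring

variable [Fintype C]

/-- The block of the adjoint of Alice's unitary which ends in a given state of `SA`. -/
def aliceBlock (U : Matrix (M × TA) (C × SA) ℂ) (s : SA) : Matrix C (TA × M) ℂ :=
  Matrix.of fun c tm => star (U (tm.2, tm.1) (c, s))

theorem sum_aliceBlock [DecidableEq M] [DecidableEq TA] {U : Matrix (M × TA) (C × SA) ℂ}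
    (hU : U * Uᴴ = 1) :
    ∑ s, (aliceBlock U s)ᴴ * aliceBlock U s = 1 := by
  ext ⟨t, m⟩ ⟨t', m'⟩
  have h := congrFun (congrFun hU (m, t)) (m', t')
  simp only [Matrix.mul_apply, Matrix.conjTranspose_apply, Fintype.sum_prod_type_right] at h
  simp only [aliceBlock, Matrix.sum_apply, Matrix.mul_apply, Matrix.conjTranspose_apply,
    Matrix.of_apply, star_star]
  rw [h]
  simp [Matrix.one_apply, and_comm]

variable [Fintype M] [Fintype TB]

/-- The ideal final state `ψ ⊗ w`, with the registers of Bob as columns. -/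
def idealMatrix (ψ : (R × C) × B → ℂ) (w : TA × TB → ℂ) :
    Matrix (R × TA) (B × (C × TB)) ℂ :=
  Matrix.of fun x y => ψ ((x.1, y.2.1), y.1) * w (x.2, y.2.2)

theorem idealMatrix_mul_conjTranspose (ψ : (R × C) × B → ℂ) (w : TA × TB → ℂ) :
    idealMatrix ψ w * (idealMatrix ψ w)ᴴ =
      ptrace2 (ptrace2 (Matrix.vecMulVec ψ (star ψ))) ⊗ₖ
        ptrace2 (Matrix.vecMulVec w (star w)) := by
  ext ⟨r, t⟩ ⟨r', t'⟩
  simp only [idealMatrix, Matrix.mul_apply, Matrix.conjTranspose_apply, Matrix.of_apply,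
    Matrix.kroneckerMap_apply, ptrace2, Matrix.vecMulVec_apply, Pi.star_apply, star_mul', Fintype.sum_prod_type]
  rw [Finset.sum_comm, Finset.sum_mul]
  refine Finset.sum_congr rfl fun c _ => ?_
  rw [Finset.sum_mul]
  refine Finset.sum_congr rfl fun b _ => ?_
  rw [Finset.mul_sum]
  refine Finset.sum_congr rfl fun k _ => ?_
  ring

/-- The ideal final state after undoing Bob's unitary. -/
def undoBob (ψ : (R × C) × B → ℂ) (w : TA × TB → ℂ)
    (V : Matrix (B × (C × TB)) (B × (SB × M)) ℂ) : Matrix (R × TA) (B × (SB × M)) ℂ :=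
  idealMatrix ψ w * (Vᵀ)ᴴ

theorem undoBob_mul_conjTranspose [DecidableEq B] [DecidableEq C] [DecidableEq TB]
    (ψ : (R × C) × B → ℂ) (w : TA × TB → ℂ)
    {V : Matrix (B × (C × TB)) (B × (SB × M)) ℂ} (hV : V * Vᴴ = 1) :
    undoBob ψ w V * (undoBob ψ w V)ᴴ = idealMatrix ψ w * (idealMatrix ψ w)ᴴ := by
  have h : (Vᵀ)ᴴ * Vᵀ = 1 := by
    have := congrArg Matrix.transpose hV
    rwa [Matrix.transpose_mul, Matrix.transpose_one] at this
  rw [undoBob, Matrix.conjTranspose_mul, Matrix.conjTranspose_conjTranspose, Matrix.mul_assoc,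
    ← Matrix.mul_assoc (Vᵀ)ᴴ, h, Matrix.one_mul]

/-- The state before Bob acts, with the message moved to the rows. -/
def undoBobRows (ψ : (R × C) × B → ℂ) (w : TA × TB → ℂ)
    (V : Matrix (B × (C × TB)) (B × (SB × M)) ℂ) : Matrix (R × (TA × M)) (B × SB) ℂ :=
  Matrix.of fun x y => undoBob ψ w V (x.1, x.2.1) (y.1, (y.2, x.2.2))

theorem undoBobRows_marginal [DecidableEq B] [DecidableEq C] [DecidableEq TB]
    (ψ : (R × C) × B → ℂ) (w : TA × TB → ℂ)
    {V : Matrix (B × (C × TB)) (B × (SB × M)) ℂ} (hV : V * Vᴴ = 1) (r : R) (t : TA) (r' : R)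
    (t' : TA) :
    ∑ m, ∑ k, undoBobRows ψ w V (r, (t, m)) k * star (undoBobRows ψ w V (r', (t', m)) k) =
      ptrace2 (ptrace2 (Matrix.vecMulVec ψ (star ψ))) r r' *
        ptrace2 (Matrix.vecMulVec w (star w)) t t' := by
  have h := congrFun (congrFun ((undoBob_mul_conjTranspose ψ w hV).trans
    (idealMatrix_mul_conjTranspose ψ w)) (r, t)) (r', t')
  rw [Matrix.kroneckerMap_apply] at h
  rw [← h, Matrix.mul_apply]
  simp only [Fintype.sum_prod_type, Matrix.conjTranspose_apply, undoBobRows, Matrix.of_apply]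
  rw [Finset.sum_comm]
  exact Finset.sum_congr rfl fun b _ => Finset.sum_comm

variable [Fintype R] [Fintype TA]

/-- The ideal final state after undoing both unitaries. -/
def undoAlice [DecidableEq R] (ψ : (R × C) × B → ℂ) (w : TA × TB → ℂ)
    (U : Matrix (M × TA) (C × SA) ℂ) (V : Matrix (B × (C × TB)) (B × (SB × M)) ℂ) :
    Matrix (R × C) (SA × (B × SB)) ℂ :=
  Matrix.of fun x y => (((1 : Matrix R R ℂ) ⊗ₖ aliceBlock U y.1) * undoBobRows ψ w V) x y.2

theorem undoAlice_mul_conjTranspose [DecidableEq R] (ψ : (R × C) × B → ℂ) (w : TA × TB → ℂ)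
    (U : Matrix (M × TA) (C × SA) ℂ) (V : Matrix (B × (C × TB)) (B × (SB × M)) ℂ) :
    undoAlice ψ w U V * (undoAlice ψ w U V)ᴴ =
      ∑ s, ((1 : Matrix R R ℂ) ⊗ₖ aliceBlock U s) *
        (undoBobRows ψ w V * (undoBobRows ψ w V)ᴴ) * ((1 : Matrix R R ℂ) ⊗ₖ aliceBlock U s)ᴴ := by
  have h : ∀ s, ((1 : Matrix R R ℂ) ⊗ₖ aliceBlock U s) *
        (undoBobRows ψ w V * (undoBobRows ψ w V)ᴴ) * ((1 : Matrix R R ℂ) ⊗ₖ aliceBlock U s)ᴴ =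
      (((1 : Matrix R R ℂ) ⊗ₖ aliceBlock U s) * undoBobRows ψ w V) *
        (((1 : Matrix R R ℂ) ⊗ₖ aliceBlock U s) * undoBobRows ψ w V)ᴴ := fun s => by
    rw [Matrix.conjTranspose_mul]
    simp only [Matrix.mul_assoc]
  simp only [h]
  ext i j
  rw [Matrix.sum_apply, Matrix.mul_apply, Fintype.sum_prod_type]
  rfl

theorem trace_undoAlice_conjTranspose_mul_initialMatrix [DecidableEq R] (ψ : (R × C) × B → ℂ)
    (θ : SA × SB → ℂ) (w : TA × TB → ℂ)
    (U : Matrix (M × TA) (C × SA) ℂ) (V : Matrix (B × (C × TB)) (B × (SB × M)) ℂ) :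
    ((undoAlice ψ w U V)ᴴ * initialMatrix ψ θ).trace =
      ∑ t, star (w t) * ∑ x, star (ψ x) * finalVec ψ θ U V (x, t) := by
  set A : SA → Matrix (R × C) (B × SB) ℂ := fun s => Matrix.of fun x y => ψ (x, y.1) * θ (s, y.2)
  set Z : Matrix (R × TA) (B × (SB × M)) ℂ :=
    Matrix.of fun x y => stepU ψ θ U ((x.1, y.1, y.2.1), (y.2.2, x.2)) with hZ
  have h1 : ((undoAlice ψ w U V)ᴴ * initialMatrix ψ θ).trace =
      ((undoBobRows ψ w V)ᴴ * ∑ s, ((1 : Matrix R R ℂ) ⊗ₖ aliceBlock U s)ᴴ * A s).trace := by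
    have : ((undoAlice ψ w U V)ᴴ * initialMatrix ψ θ).trace =
        ∑ s, ((((1 : Matrix R R ℂ) ⊗ₖ aliceBlock U s) * undoBobRows ψ w V)ᴴ * A s).trace := by
      rw [Matrix.trace, Fintype.sum_prod_type]
      rfl
    rw [this, Matrix.mul_sum, Matrix.trace_sum]
    refine Finset.sum_congr rfl fun s _ => ?_
    rw [Matrix.conjTranspose_mul, Matrix.mul_assoc]
  have h2 : ∑ s, ((1 : Matrix R R ℂ) ⊗ₖ aliceBlock U s)ᴴ * A s =
      Matrix.of fun x y => Z (x.1, x.2.1) (y.1, (y.2, x.2.2)) := by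
    ext ⟨r, t, m⟩ ⟨b, s'⟩
    simp only [Matrix.sum_apply, Matrix.mul_apply, Matrix.conjTranspose_kronecker,
      Matrix.conjTranspose_one, Matrix.kroneckerMap_apply, Matrix.of_apply, hZ, stepU, A,
      Fintype.sum_prod_type, aliceBlock, Matrix.conjTranspose_apply, star_star]
    rw [Finset.sum_comm (γ := C)]
    refine Finset.sum_congr rfl fun s _ => ?_
    rw [Finset.sum_eq_single r (fun r' _ hr => by simp [Matrix.one_apply_ne' hr]) (by simp)]
    refine Finset.sum_congr rfl fun c _ => ?_
    rw [Matrix.one_apply_eq, one_mul, mul_assoc]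
  have h3 : ((undoBobRows ψ w V)ᴴ * Matrix.of fun (x : R × (TA × M)) (y : B × SB) =>
        Z (x.1, x.2.1) (y.1, (y.2, x.2.2))).trace = ((undoBob ψ w V)ᴴ * Z).trace := by
    rw [trace_conjTranspose_mul, trace_conjTranspose_mul]
    simp only [Fintype.sum_prod_type, undoBobRows, Matrix.of_apply]
    refine Finset.sum_congr rfl fun r _ => Finset.sum_congr rfl fun t _ => ?_
    rw [Finset.sum_comm]
    exact Finset.sum_congr rfl fun b _ => Finset.sum_comm
  have h4 : Z * Vᵀ = Matrix.of fun x y => stepV ψ θ U V (x, y) := by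
    ext x y
    simp only [Matrix.mul_apply, Matrix.of_apply, hZ, stepV, Matrix.transpose_apply]
    exact Finset.sum_congr rfl fun _ _ => mul_comm _ _
  rw [h1, h2, h3, undoBob, Matrix.conjTranspose_mul, Matrix.conjTranspose_conjTranspose,
    Matrix.mul_assoc, Matrix.trace_mul_comm, Matrix.mul_assoc, h4, trace_conjTranspose_mul]
  simp only [idealMatrix, Matrix.of_apply, star_mul', finalVec, Finset.mul_sum]
  rw [← Fintype.sum_prod_type', ← Fintype.sum_prod_type']
  refine Fintype.sum_equiv
    { toFun := fun p => ((p.1.2, p.2.2.2), ((p.1.1, p.2.2.1), p.2.1))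
      invFun := fun q => ((q.2.1.1, q.1.1), (q.2.2, (q.2.1.2, q.1.2)))
      left_inv := fun _ => rfl
      right_inv := fun _ => rfl } _ _ fun p => ?_
  simp only [Equiv.coe_fn_mk]
  ring

end StateMerging

/-- **Lower bound for quantum state merging.** Any one-way entanglement-assisted
state-merging protocol with error `ε` must communicate at least
`(1/2)·Imax^ε(R:C)_{Ψ_RC}` qubits. -/
theorem state_merging_lower_bound
    {R B C SA SB M TA TB : Type}
    [Fintype R] [Fintype B] [Fintype C] [Fintype SA] [Fintype SB]
    [Fintype M] [Fintype TA] [Fintype TB]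
    [DecidableEq R] [DecidableEq B] [DecidableEq C] [DecidableEq SA]
    [DecidableEq SB] [DecidableEq M] [DecidableEq TA] [DecidableEq TB]
    [Nonempty R] [Nonempty B] [Nonempty C] [Nonempty SA] [Nonempty SB]
    [Nonempty M] [Nonempty TA] [Nonempty TB]
    (ε : ℝ) (hε : 0 < ε)
    (ψ : (R × C) × B → ℂ) (hψ : ∑ i, ‖ψ i‖ ^ 2 = 1)
    (hcard1 : Fintype.card C * Fintype.card SA = Fintype.card M * Fintype.card TA)
    (hcard2 : Fintype.card SB * Fintype.card M = Fintype.card C * Fintype.card TB)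
    (θ : SA × SB → ℂ) (hθ : ∑ i, ‖θ i‖ ^ 2 = 1)
    (U : Matrix (M × TA) (C × SA) ℂ)
    (hU1 : U * Uᴴ = 1) (hU2 : Uᴴ * U = 1)
    (V : Matrix (B × (C × TB)) (B × (SB × M)) ℂ)
    (hV1 : V * Vᴴ = 1) (hV2 : Vᴴ * V = 1)
    (hout : IsDensityMatrix
        (ptrace2 (Matrix.vecMulVec (finalVec ψ θ U V) (star (finalVec ψ θ U V)))) ∧
      pdist (Matrix.vecMulVec ψ (star ψ))
        (ptrace2 (Matrix.vecMulVec (finalVec ψ θ U V) (star (finalVec ψ θ U V)))) ≤ ε) :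
    ((1 / 2 : ℝ) : EReal) * imaxEps ε (ptrace2 (Matrix.vecMulVec ψ (star ψ)))
      ≤ ((Real.logb 2 (Fintype.card M) : ℝ) : EReal) := by
  set f := finalVec ψ θ U V
  obtain ⟨w, hw, hwo⟩ := exists_unit_vector_sum_eq fun t => ∑ x, star (ψ x) * f (x, t)
  set F := fidelity (Matrix.vecMulVec ψ (star ψ)) (ptrace2 (Matrix.vecMulVec f (star f)))
  have hF0 : 0 ≤ F := fidelity_nonneg _ _
  set N := undoAlice ψ w U V
  have hFN : F ≤ fidelity (ptrace2 (Matrix.vecMulVec ψ (star ψ))) (N * Nᴴ) := by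
    have h1 := norm_trace_le_fidelity (initialMatrix ψ θ) N
    rw [initialMatrix_mul_conjTranspose ψ hθ] at h1
    refine le_trans ?_ h1
    rw [← norm_star, ← Matrix.trace_conjTranspose, Matrix.conjTranspose_mul,
      Matrix.conjTranspose_conjTranspose, trace_undoAlice_conjTranspose_mul_initialMatrix, hwo,
      Complex.norm_real, Real.norm_of_nonneg (Real.sqrt_nonneg _),
      ← dotProduct_ptrace2_vecMulVec]
    exact Real.le_sqrt_of_sq_le (fidelity_pure_sq_le ψ hout.1.1)
  have hω : IsDensityMatrix (ptrace2 (Matrix.vecMulVec w (star w))) :=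
    isDensityMatrix_ptrace2_vecMulVec hw
  have hL := sum_aliceBlock hU1
  have hN := undoAlice_mul_conjTranspose ψ w U V
  have hdens : IsDensityMatrix (N * Nᴴ) := by
    refine ⟨Matrix.posSemidef_self_mul_conjTranspose _, ?_⟩
    rw [trace_eq_trace_ptrace2, hN, ptrace2_sum_one_kronecker_conj _ hL,
      ptrace2_mul_conjTranspose_of_marginal _ _ hω (undoBobRows_marginal ψ w hV1),
      ← trace_eq_trace_ptrace2]
    exact (isDensityMatrix_ptrace2_vecMulVec hψ).2
  have hdist : pdist (ptrace2 (Matrix.vecMulVec ψ (star ψ))) (N * Nᴴ) ≤ ε := by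
    refine le_trans (Real.sqrt_le_sqrt ?_) hout.2
    gcongr
  have hmax : imaxEps ε (ptrace2 (Matrix.vecMulVec ψ (star ψ))) ≤
      ((2 * Real.logb 2 (Fintype.card M) : ℝ) : EReal) := by
    refine (iInf_le _ ⟨N * Nᴴ, hdens, hdist⟩).trans ?_
    change imax (N * Nᴴ) ≤ _
    rw [hN]
    exact imax_sum_one_kronecker_conj_le _ _ hω (undoBobRows_marginal ψ w hV1) _ hL
  calc _ ≤ ((1 / 2 : ℝ) : EReal) * ((2 * Real.logb 2 (Fintype.card M) : ℝ) : EReal) :=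
        mul_le_mul_of_nonneg_left hmax (by exact_mod_cast (by norm_num : (0 : ℝ) ≤ 1 / 2))
    _ = _ := by
        rw [← EReal.coe_mul]
        congr 1
        ring

end
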